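/- arXiv:2306.10838 — 2 statements merged into one kernel-verified Lean document; each statement's English description precedes it below -/
import Mathlib

section
/- Let p be a prime, k ≥ 1 and m = p^k. For a Laurent polynomial A over ZMod m, let A* be the Laurent polynomial whose i-th coefficient equals the i-th coefficient of A whenever that coefficient is a unit of ZMod m, and 0 otherwise. Then A^{p^{k−1}} = (A*)^{p^{k−1}} in the Laurent polynomial ring over ZMod m. -/
/-- Identification of `ZZ ->0 ZMod m` with the Laurent polynomial ring
`(ZMod m)[X,X^-1] = AddMonoidAlgebra (ZMod m) ZZ`. -/
def toLP (m : ℕ) (a : ℤ →₀ ZMod m) : AddMonoidAlgebra (ZMod m) ℤ := .ofCoeff a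

/-- Inverse identification. -/
def ofLP (m : ℕ) (a : AddMonoidAlgebra (ZMod m) ℤ) : ℤ →₀ ZMod m := a.coeff

/-- The reduced Laurent polynomial: keep exactly the coefficients that are units of
`ZMod m`, replace the others by `0`. -/
noncomputable def redLam (m : ℕ) (A : ℤ →₀ ZMod m) : ℤ →₀ ZMod m :=
  letI := Classical.decPred fun i : ℤ => IsUnit (A i)
  A.filter fun i => IsUnit (A i)

lemma dvd_of_not_isUnit_zmod (p : ℕ) (hp : p.Prime) (k : ℕ) (x : ZMod (p ^ k))
    (hx : ¬ IsUnit x) : (p : ZMod (p ^ k)) ∣ x := by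
  haveI : NeZero (p ^ k) := ⟨pow_ne_zero _ hp.ne_zero⟩
  rw [← ZMod.natCast_zmod_val x] at hx ⊢
  rw [ZMod.isUnit_iff_coprime] at hx
  have h : p ∣ x.val := by
    by_contra h
    exact hx (((Nat.Prime.coprime_iff_not_dvd hp).2 h).symm.pow_right k)
  exact_mod_cast (Nat.cast_dvd_cast h : ((p : ℕ) : ZMod (p ^ k)) ∣ _)

lemma toLP_dvd (p m : ℕ) (B : ℤ →₀ ZMod m) (h : ∀ i, (p : ZMod m) ∣ B i) :
    (p : AddMonoidAlgebra (ZMod m) ℤ) ∣ toLP m B := by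
  choose g hg using h
  let C : ℤ →₀ ZMod m := Finsupp.onFinset B.support (fun i => if B i = 0 then 0 else g i)
    (by intro i hi; simp at hi; simp [hi.1])
  refine ⟨toLP m C, ?_⟩
  rw [← nsmul_eq_mul]
  ext i
  rw [AddMonoidAlgebra.coeff_smul, Finsupp.smul_apply, nsmul_eq_mul]
  change B i = (p : ZMod m) * C i
  by_cases h0 : B i = 0
  · simp [C, h0]
  · simp [C, h0, ← hg]

theorem stmt3 (p : ℕ) (hp : p.Prime) (k : ℕ) (hk : 1 ≤ k) (A : ℤ →₀ ZMod (p ^ k)) :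
    toLP (p ^ k) A ^ p ^ (k - 1) = toLP (p ^ k) (redLam (p ^ k) A) ^ p ^ (k - 1) := by
  have h1 : (p : AddMonoidAlgebra (ZMod (p ^ k)) ℤ) ∣
      toLP (p ^ k) A - toLP (p ^ k) (redLam (p ^ k) A) := by
    have : toLP (p ^ k) A - toLP (p ^ k) (redLam (p ^ k) A)
        = toLP (p ^ k) (A - redLam (p ^ k) A) := rfl
    rw [this]
    apply toLP_dvd
    intro i
    classical
    by_cases hu : IsUnit (A i)
    · simp [redLam, Finsupp.filter_apply, hu]
    · simpa [redLam, Finsupp.filter_apply, hu] using dvd_of_not_isUnit_zmod p hp k _ hu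
  have h2 := dvd_sub_pow_of_dvd_sub h1 (k - 1)
  rw [Nat.sub_add_cancel hk] at h2
  have h3 : ((p : AddMonoidAlgebra (ZMod (p ^ k)) ℤ)) ^ k = 0 := by
    have h4 : ((p ^ k : ℕ) : ZMod (p ^ k)) = 0 := ZMod.natCast_self _
    have h5 := congrArg (algebraMap (ZMod (p ^ k)) (AddMonoidAlgebra (ZMod (p ^ k)) ℤ)) h4
    rw [map_natCast, map_zero, Nat.cast_pow] at h5
    exact h5
  rw [h3, zero_dvd_iff] at h2
  exact sub_eq_zero.1 h2
end

section
/- Let p be a prime, k ≥ 1 and m = p^k. Let A be a Laurent polynomial over ZMod m whose reduced support supp*(A) := {i ∈ ℤ : the i-th coefficient of A is a unit of ZMod m} is nonempty, and set l' := min supp*(A), r' := max supp*(A). Then A^{p^{k−1}} ≠ 0 and the support of A^{p^{k−1}} has minimum p^{k−1}·l' and maximum p^{k−1}·r'. -/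
/-- The reduced support `supp*(A) = {i : the i-th coefficient of A is a unit of ZMod m}`. -/
noncomputable def redSupp (m : ℕ) (A : ℤ →₀ ZMod m) : Finset ℤ :=
  letI := Classical.decPred fun i : ℤ => IsUnit (A i)
  A.support.filter fun i => IsUnit (A i)

theorem low_mul {R : Type*} [CommRing R] (x y : AddMonoidAlgebra R ℤ) (a b : ℤ)
    (hx : ∀ i < a, x.coeff i = 0) (hy : ∀ i < b, y.coeff i = 0) :
    (∀ i < a + b, (x * y).coeff i = 0) ∧ (x * y).coeff (a + b) = x.coeff a * y.coeff b := by
  constructor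
  · intro i hi
    rw [AddMonoidAlgebra.coeff_mul_apply_left]
    refine Finset.sum_eq_zero fun j _ => ?_
    rcases lt_or_ge j a with h | h
    · simp [hx j h]
    · simp [hy (-j + i) (by omega)]
  · rw [AddMonoidAlgebra.coeff_mul_apply_left, Finsupp.sum, Finset.sum_eq_single a]
    · simp
    · intro j _ hj
      rcases lt_or_ge j a with h | h
      · simp [hx j h]
      · have h1 : -j + (a + b) < b := by omega
        simp [hy _ h1]
    · intro h
      simp [Finsupp.notMem_support_iff.1 h]

theorem low_pow {R : Type*} [CommRing R] (x : AddMonoidAlgebra R ℤ) (a : ℤ)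
    (hx : ∀ i < a, x.coeff i = 0) (n : ℕ) :
    (∀ i < n * a, (x ^ n).coeff i = 0) ∧ (x ^ n).coeff (n * a) = x.coeff a ^ n := by
  induction n with
  | zero =>
    constructor
    · intro i hi
      have h : (0 : ℤ) ≠ i := by
        simp at hi
        omega
      rw [pow_zero, AddMonoidAlgebra.one_def]
      exact Finsupp.single_eq_of_ne h.symm
    · rw [pow_zero, pow_zero, AddMonoidAlgebra.one_def, Nat.cast_zero, zero_mul]
      exact Finsupp.single_eq_same
  | succ n ih =>
    have := low_mul (x ^ n) x (n * a) a ih.1 hx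
    have e : ((n + 1 : ℕ) : ℤ) * a = n * a + a := by push_cast; ring
    rw [e, pow_succ, pow_succ, ← ih.2]
    exact this

theorem high_pow {R : Type*} [CommRing R] (x : AddMonoidAlgebra R ℤ) (a : ℤ)
    (hx : ∀ i > a, x.coeff i = 0) (n : ℕ) :
    (∀ i > n * a, (x ^ n).coeff i = 0) ∧ (x ^ n).coeff (n * a) = x.coeff a ^ n := by
  have key : ∀ (z : AddMonoidAlgebra R ℤ) (i : ℤ),
      (LaurentPolynomial.invert (R := R) z).coeff i = z.coeff (-i) :=
    fun z i => LaurentPolynomial.invert_apply z i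
  have := low_pow (LaurentPolynomial.invert (R := R) x) (-a)
    (fun i hi => by rw [key]; exact hx _ (by omega)) n
  have e : (LaurentPolynomial.invert (R := R) x) ^ n = LaurentPolynomial.invert (R := R) (x ^ n) :=
    (map_pow _ _ _).symm
  rw [e] at this
  obtain ⟨h1, h2⟩ := this
  rw [key, key] at h2
  refine ⟨fun i hi => ?_, by simpa using h2⟩
  have := h1 (-i) (by rw [mul_neg]; omega)
  rwa [key, neg_neg] at this

theorem dvd_of_not_unit (p : ℕ) (hp : p.Prime) (k : ℕ) (c : ZMod (p ^ k)) (h : ¬ IsUnit c) :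
    ∃ d : ZMod (p ^ k), c = p * d := by
  have : NeZero (p ^ k) := ⟨pow_ne_zero _ hp.ne_zero⟩
  have hc : ((c.val : ℕ) : ZMod (p ^ k)) = c := ZMod.natCast_zmod_val c
  rw [← hc, ZMod.isUnit_iff_coprime] at h
  have h2 : p ∣ c.val := by
    by_contra h3
    exact h (Nat.Coprime.pow_right _ ((hp.coprime_iff_not_dvd.2 h3).symm))
  obtain ⟨d, hd⟩ := h2
  exact ⟨d, by rw [← hc, hd]; push_cast; rfl⟩

theorem mem_redSupp (m : ℕ) (hm : 1 < m) (A : ℤ →₀ ZMod m) (i : ℤ) :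
    i ∈ redSupp m A ↔ IsUnit (A i) := by
  have : Fact (1 < m) := ⟨hm⟩
  unfold redSupp
  simp only [Finset.mem_filter, Finsupp.mem_support_iff]
  exact ⟨fun h => h.2, fun h => ⟨h.ne_zero, h⟩⟩

theorem exists_reduced (p : ℕ) (hp : p.Prime) (k : ℕ) (hk : 1 ≤ k) (A : ℤ →₀ ZMod (p ^ k)) :
    ∃ B : AddMonoidAlgebra (ZMod (p ^ k)) ℤ,
      (∀ i, i ∈ redSupp (p ^ k) A → B.coeff i = A i) ∧
      (∀ i, i ∉ redSupp (p ^ k) A → B.coeff i = 0) ∧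
      toLP (p ^ k) A ^ p ^ (k - 1) = B ^ p ^ (k - 1) := by
  classical
  have hm : 1 < p ^ k := Nat.one_lt_pow (by omega) hp.one_lt
  let B : AddMonoidAlgebra (ZMod (p ^ k)) ℤ := .ofCoeff (A.filter (· ∈ redSupp (p ^ k) A))
  have hB : ∀ i, B.coeff i = if i ∈ redSupp (p ^ k) A then A i else 0 := fun i =>
    Finsupp.filter_apply _ _ _
  refine ⟨B, fun i hi => by rw [hB, if_pos hi], fun i hi => by rw [hB, if_neg hi], ?_⟩
  have hd : ∀ c : ZMod (p ^ k), ∃ d : ZMod (p ^ k), ¬ IsUnit c → c = p * d := by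
    intro c
    by_cases h : IsUnit c
    · exact ⟨0, fun h' => absurd h h'⟩
    · obtain ⟨d, hd⟩ := dvd_of_not_unit p hp k c h
      exact ⟨d, fun _ => hd⟩
  choose d hd using hd
  let D : AddMonoidAlgebra (ZMod (p ^ k)) ℤ :=
    .ofCoeff (Finsupp.onFinset A.support
      (fun i => if i ∈ A.support ∧ i ∉ redSupp (p ^ k) A then d (A i) else 0)
      (fun i hi => by by_contra h; exact hi (if_neg fun h' => h h'.1)))
  have hD : ∀ i, D.coeff i = if i ∈ A.support ∧ i ∉ redSupp (p ^ k) A then d (A i) else 0 :=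
    fun i => rfl
  have hdvd : (p : AddMonoidAlgebra (ZMod (p ^ k)) ℤ) ∣ toLP (p ^ k) A - B := by
    refine ⟨D, ?_⟩
    rw [← nsmul_eq_mul]
    ext i
    have h1 : (toLP (p ^ k) A - B).coeff i = A i - B.coeff i := rfl
    have h2 : (p • D).coeff i = p • D.coeff i := rfl
    rw [h1, h2, hB, hD, nsmul_eq_mul]
    by_cases hi : i ∈ redSupp (p ^ k) A
    · simp [hi]
    · by_cases h0 : A i = 0
      · simp [h0]
      · have := hd (A i) (fun h => hi ((mem_redSupp _ hm A i).2 h))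
        simpa [hi, h0] using this
  have := dvd_sub_pow_of_dvd_sub hdvd (k - 1)
  rw [Nat.sub_add_cancel hk] at this
  have hz : (p : AddMonoidAlgebra (ZMod (p ^ k)) ℤ) ^ k = 0 := by
    have h0 : ((p ^ k : ℕ) : ZMod (p ^ k)) = 0 := ZMod.natCast_self _
    have := map_natCast (algebraMap (ZMod (p ^ k)) (AddMonoidAlgebra (ZMod (p ^ k)) ℤ)) (p ^ k)
    rw [h0, map_zero] at this
    rw [← Nat.cast_pow, ← this]
  rw [hz, zero_dvd_iff, sub_eq_zero] at this
  exact this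

theorem stmt14 (p : ℕ) (hp : p.Prime) (k : ℕ) (hk : 1 ≤ k) (A : ℤ →₀ ZMod (p ^ k))
    (hne : (redSupp (p ^ k) A).Nonempty) :
    toLP (p ^ k) A ^ p ^ (k - 1) ≠ 0 ∧
    (ofLP (p ^ k) (toLP (p ^ k) A ^ p ^ (k - 1))).support.min
      = (((p : ℤ) ^ (k - 1) * (redSupp (p ^ k) A).min' hne : ℤ) : WithBot ℤ) ∧
    (ofLP (p ^ k) (toLP (p ^ k) A ^ p ^ (k - 1))).support.max
      = (((p : ℤ) ^ (k - 1) * (redSupp (p ^ k) A).max' hne : ℤ) : WithTop ℤ) := by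
  have hm : 1 < p ^ k := Nat.one_lt_pow (by omega) hp.one_lt
  have : Fact (1 < p ^ k) := ⟨hm⟩
  obtain ⟨B, hB1, hB2, hAB⟩ := exists_reduced p hp k hk A
  rw [hAB]
  have hl := Finset.min'_mem _ hne
  have hr := Finset.max'_mem _ hne
  obtain ⟨l1, l2⟩ := low_pow B ((redSupp (p ^ k) A).min' hne)
    (fun i hi => hB2 i fun h => absurd (Finset.min'_le _ _ h) (not_le.2 hi)) (p ^ (k - 1))
  obtain ⟨r1, r2⟩ := high_pow B ((redSupp (p ^ k) A).max' hne)
    (fun i hi => hB2 i fun h => absurd (Finset.le_max' _ _ h) (not_le.2 hi)) (p ^ (k - 1))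
  rw [hB1 _ hl] at l2
  rw [hB1 _ hr] at r2
  have l3 := (((mem_redSupp _ hm A _).1 hl).pow (p ^ (k - 1))).ne_zero
  have r3 := (((mem_redSupp _ hm A _).1 hr).pow (p ^ (k - 1))).ne_zero
  rw [← l2] at l3
  rw [← r2] at r3
  rw [Nat.cast_pow] at l1 l3 r1 r3
  refine ⟨fun h => l3 (by rw [h]; rfl), ?_, ?_⟩
  · refine le_antisymm (α := WithTop ℤ)
      (Finset.min_le (Finsupp.mem_support_iff.2 l3)) (Finset.le_min fun i hi => ?_)
    refine WithTop.coe_le_coe.2 (not_lt.1 fun h => ?_)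
    exact Finsupp.mem_support_iff.1 hi (l1 i h)
  · refine le_antisymm (α := WithBot ℤ) (Finset.max_le fun i hi => ?_)
      (Finset.le_max (Finsupp.mem_support_iff.2 r3))
    refine WithBot.coe_le_coe.2 (not_lt.1 fun h => ?_)
    exact Finsupp.mem_support_iff.1 hi (r1 i h)
end
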